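/- Let p ≥ 5 be a prime and let G be an Abelian group of order 8p^3 that contains a nontrivial regular (8p^3,k,λ,μ)-partial difference set. Then G is isomorphic to (ℤ/2ℤ)^3 × (ℤ/pℤ)^3. -/

import Mathlib

variable {G : Type*} [CommGroup G] [DecidableEq G] [Fintype G]

/-- The number of representations of `g` as `d₁ * d₂⁻¹` with `d₁, d₂ ∈ D`, `d₁ ≠ d₂`. -/
def pdsReps (D : Finset G) (g : G) : ℕ :=
  ((D ×ˢ D).filter (fun x => x.1 ≠ x.2 ∧ x.1 * x.2⁻¹ = g)).card

/-- `D` is a `(v,k,λ,μ)`-partial difference set in `G`. -/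
def IsPDS (D : Finset G) (v k l m : ℕ) : Prop :=
  Fintype.card G = v ∧ D.card = k ∧
  (∀ g : G, g ≠ 1 → g ∈ D → pdsReps D g = l) ∧
  (∀ g : G, g ≠ 1 → g ∉ D → pdsReps D g = m)

/-- `D` is regular: closed under inverses and not containing the identity. -/
def IsRegularPDS (D : Finset G) : Prop :=
  (∀ d ∈ D, d⁻¹ ∈ D) ∧ (1 : G) ∉ D

/-- A regular PDS is trivial if `D ∪ {e}` or `G \ D` is a subgroup. -/
def IsTrivialPDS (D : Finset G) : Prop :=
  (∃ H : Subgroup G, (H : Set G) = ↑D ∪ {1}) ∨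
  (∃ H : Subgroup G, (H : Set G) = (↑D : Set G)ᶜ)
section OrbitSum

variable {A M : Type*} [CommGroup A] [AddCommMonoid M]

lemma pow_mul_add_one_pow {q w : ℕ} (hqw : q ∣ w) (hexp : ∀ a : A, a ^ (w * q) = 1) (a : A)
    (i j : ℕ) : (a ^ (w * i + 1)) ^ (w * j + 1) = a ^ (w * (i + j) + 1) := by
  obtain ⟨t, rfl⟩ := hqw
  have h : (q * t * i + 1) * (q * t * j + 1)
      = (q * t * (i + j) + 1) + (q * t * q) * (t * i * j) := by ring
  rw [← pow_mul, h, pow_add, pow_mul a (q * t * q), hexp, one_pow, mul_one]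

lemma sum_mem_of_orbit_sums_mem (N : AddSubmonoid M) {q w : ℕ} (hq : q.Prime) (hqw : q ∣ w)
    (hexp : ∀ a : A, a ^ (w * q) = 1) (T : A → M) (S : Finset A)
    (hS : ∀ a ∈ S, a ^ (w + 1) ∈ S) (hne : ∀ a ∈ S, a ^ w ≠ 1)
    (hT : ∀ a ∈ S, ∑ j ∈ Finset.range q, T (a ^ (w * j + 1)) ∈ N) :
    ∑ a ∈ S, T a ∈ N := by
  classical
  induction S using Finset.strongInduction with
  | H S ih =>
    rcases S.eq_empty_or_nonempty with rfl | ⟨a, ha⟩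
    · simp
    set O := (Finset.range q).image (fun j => a ^ (w * j + 1)) with hO
    have hmem : ∀ i, a ^ (w * i + 1) ∈ O := by
      intro i
      refine Finset.mem_image.2 ⟨i % q, Finset.mem_range.2 (Nat.mod_lt _ hq.pos), ?_⟩
      conv_rhs => rw [← Nat.mod_add_div i q]
      rw [show w * (i % q + q * (i / q)) + 1 = (w * (i % q) + 1) + (w * q) * (i / q) by ring,
        pow_add _ (_ + 1), pow_mul _ (w * q), hexp, one_pow, mul_one]
    have hOS : O ⊆ S := by
      intro b hb
      obtain ⟨j, -, rfl⟩ := Finset.mem_image.1 hb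
      clear hb
      induction j with
      | zero => simpa using ha
      | succ j hj =>
        have := hS _ hj
        have h1 := pow_mul_add_one_pow hqw hexp a j 1
        rw [mul_one] at h1
        rwa [h1] at this
    have hinj : Set.InjOn (fun j => a ^ (w * j + 1)) (Finset.range q : Set ℕ) := by
      intro i hi j hj hij
      have hord : orderOf (a ^ w) = q :=
        haveI := Fact.mk hq
        orderOf_eq_prime (by rw [← pow_mul, hexp]) (hne a ha)
      simp only [pow_succ, mul_left_inj, pow_mul] at hij
      rw [Finset.coe_range] at hi hj
      exact pow_injOn_Iio_orderOf (hord.symm ▸ hi) (hord.symm ▸ hj) hij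
    rw [← Finset.sum_sdiff hOS]
    refine N.add_mem (ih _ (Finset.sdiff_ssubset hOS ⟨_, hmem 0⟩) ?_ ?_ ?_) ?_
    · intro b hb
      rw [Finset.mem_sdiff] at hb ⊢
      refine ⟨hS b hb.1, fun h => hb.2 ?_⟩
      obtain ⟨j, -, hj⟩ := Finset.mem_image.1 h
      have h1 := pow_mul_add_one_pow hqw hexp b 1 (q - 1)
      rw [mul_one, ← hj, pow_mul_add_one_pow hqw hexp,
        show 1 + (q - 1) = q from Nat.add_sub_cancel' hq.one_le, pow_succ b, hexp, one_mul] at h1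
      exact h1 ▸ hmem _
    · exact fun b hb => hne b (Finset.mem_sdiff.1 hb).1
    · exact fun b hb => hT b (Finset.mem_sdiff.1 hb).1
    · rw [hO, Finset.sum_image hinj]
      exact hT a ha

end OrbitSum

section Divisibility

/-- Complex numbers `q * y` with `y` an algebraic integer some power of which is divisible by
`q`. -/
noncomputable def strictMultiples (q : ℕ) : AddSubgroup ℂ where
  carrier := {x | ∃ y ∈ (Ideal.span {(q : integralClosure ℤ ℂ)}).radical, (q : ℂ) * y = x}
  zero_mem' := ⟨0, Ideal.zero_mem _, by simp⟩
  add_mem' := by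
    rintro _ _ ⟨y, hy, rfl⟩ ⟨z, hz, rfl⟩
    exact ⟨y + z, Ideal.add_mem _ hy hz, by push_cast; ring⟩
  neg_mem' := by
    rintro _ ⟨y, hy, rfl⟩
    exact ⟨-y, neg_mem hy, by push_cast; ring⟩

lemma sq_dvd_of_mem_strictMultiples {q : ℕ} (hq : q.Prime) {N : ℤ}
    (h : (N : ℂ) ∈ strictMultiples q) : (q : ℤ) ^ 2 ∣ N := by
  obtain ⟨y, ⟨n, hn⟩, hN⟩ := h
  obtain ⟨c, hc⟩ := Ideal.mem_span_singleton.1 hn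
  have hq0 : (q : ℂ) ≠ 0 := Nat.cast_ne_zero.2 hq.ne_zero
  have hrat : ∀ r : ℚ, IsIntegral ℤ (r : ℂ) → ∃ t : ℤ, r = t := by
    intro r hr
    have : IsIntegral ℤ r := by
      rw [← isIntegral_algebraMap_iff (algebraMap ℚ ℂ).injective]
      simpa using hr
    obtain ⟨t, ht⟩ := IsIntegrallyClosed.isIntegral_iff.1 this
    exact ⟨t, by simpa using ht.symm⟩
  have hy : (y : ℂ) = ((N / q : ℚ) : ℂ) := by
    push_cast
    rw [← hN]
    field_simp
  obtain ⟨t, ht⟩ := hrat _ (hy ▸ y.2)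
  have hyt : (y : ℂ) = t := by rw [hy, ht]; simp
  have hNt : N = q * t := by
    have : (N : ℂ) = ((q * t : ℤ) : ℂ) := by rw [← hN, hyt]; push_cast; rfl
    exact_mod_cast this
  have hc' : (t : ℂ) ^ n = q * c := by
    have := congrArg (Subtype.val) hc
    push_cast at this
    rw [← hyt, this]
  have hcr : (c : ℂ) = ((t ^ n / q : ℚ) : ℂ) := by
    push_cast
    rw [hc']
    field_simp
  obtain ⟨r, hr⟩ := hrat _ (hcr ▸ c.2)
  have hcr' : (c : ℂ) = r := by rw [hcr, hr]; simp
  have hdvd : (q : ℤ) ∣ t ^ n := ⟨r, by rw [hcr'] at hc'; exact_mod_cast hc'⟩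
  rw [hNt, pow_two]
  exact mul_dvd_mul_left _ ((Nat.prime_iff_prime_int.1 hq).dvd_of_dvd_pow hdvd)

lemma sub_one_mul_mem_strictMultiples {q : ℕ} (hq : q.Prime) {ζ y : ℂ} (hζ : ζ ^ q = 1)
    (hy : IsIntegral ℤ y) : (ζ - 1) * (q * y) ∈ strictMultiples q := by
  have hζi : IsIntegral ℤ ζ := IsIntegral.of_pow hq.pos (hζ ▸ isIntegral_one)
  let z : integralClosure ℤ ℂ := ⟨ζ, hζi⟩
  have hz : z ^ q = 1 := Subtype.ext (by simpa [z] using hζ)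
  refine ⟨(z - 1) * ⟨y, hy⟩, Ideal.mul_mem_right _ _ ⟨q, ?_⟩, by simp [z]; ring⟩
  rw [Ideal.mem_span_singleton]
  obtain ⟨r, hr⟩ := exists_add_pow_prime_eq hq z (-1)
  rw [sub_eq_add_neg, hr, hz]
  have h1 : (q : integralClosure ℤ ℂ) ∣ 1 + (-1) ^ q := by
    rcases hq.eq_two_or_odd' with rfl | h
    · exact ⟨1, by norm_num⟩
    · simp [h.neg_one_pow]
  exact dvd_add h1 ⟨z * -1 * r, by ring⟩

lemma geom_sum_eq_zero_or {q : ℕ} {ω : ℂ} (hω : ω ^ q = 1) :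
    ∑ j ∈ Finset.range q, ω ^ j = 0 ∨ ∑ j ∈ Finset.range q, ω ^ j = q := by
  by_cases h : ω = 1
  · right; simp [h]
  · left
    have := mul_neg_geom_sum ω q
    rw [hω, sub_self] at this
    exact (mul_eq_zero.1 this).resolve_left (sub_ne_zero.2 (Ne.symm h))

lemma sum_sub_one_mul_mem_strictMultiples {q : ℕ} (hq : q.Prime) {ζ y ω : ℂ} (hζ : ζ ^ q = 1)
    (hω : ω ^ q = 1) (hy : IsIntegral ℤ y) :
    ∑ j ∈ Finset.range q, (ζ - 1) * (y * ω ^ j) ∈ strictMultiples q := by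
  rw [← Finset.mul_sum, ← Finset.mul_sum]
  rcases geom_sum_eq_zero_or hω with h | h <;> rw [h]
  · simp
  · rw [mul_comm y]
    exact sub_one_mul_mem_strictMultiples hq hζ hy

end Divisibility

section Characters

variable {A : Type*} [CommGroup A]

lemma addChar_apply_pow (χ : AddChar (Additive A) ℂ) (g : A) (n : ℕ) :
    χ (.ofMul (g ^ n)) = χ (.ofMul g) ^ n := by
  rw [ofMul_pow, AddChar.map_nsmul_eq_pow]

lemma addChar_apply_mul (χ : AddChar (Additive A) ℂ) (g h : A) :
    χ (.ofMul (g * h)) = χ (.ofMul g) * χ (.ofMul h) := by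
  rw [ofMul_mul, AddChar.map_add_eq_mul]

lemma addChar_apply_one (χ : AddChar (Additive A) ℂ) : χ (.ofMul (1 : A)) = 1 := by
  rw [ofMul_one, AddChar.map_zero_eq_one]

lemma addChar_pow_eq_one {n : ℕ} (h : ∀ g : A, g ^ n = 1) (χ : AddChar (Additive A) ℂ) :
    χ ^ n = 1 := by
  ext g
  rw [AddChar.pow_apply, ← ofMul_toMul g, ← addChar_apply_pow, h, addChar_apply_one,
    AddChar.one_apply]

lemma pow_mul_self_eq_one {q w : ℕ} (hqw : q ∣ w) (hexp : ∀ g : A, g ^ (w * q) = 1) (z : A) :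
    z ^ (w * w) = 1 := by
  obtain ⟨t, rfl⟩ := hqw
  rw [← mul_assoc, pow_mul, hexp, one_pow]

variable [Fintype A]

lemma isIntegral_addChar_apply (χ : AddChar (Additive A) ℂ) (g : A) :
    IsIntegral ℤ (χ (.ofMul g)) := by
  refine IsIntegral.of_pow (Fintype.card_pos (α := A)) ?_
  rw [← addChar_apply_pow, pow_card_eq_one, addChar_apply_one]
  exact isIntegral_one

lemma fourier_inversion (F : A → ℂ) (g : A) :
    ∑ χ : AddChar (Additive A) ℂ, (∑ h, F h * χ (.ofMul h)) * χ (.ofMul g⁻¹)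
      = Fintype.card A * F g := by
  classical
  simp_rw [Finset.sum_mul]
  rw [Finset.sum_comm]
  simp_rw [mul_assoc, ← addChar_apply_mul, ← Finset.mul_sum, AddChar.sum_apply_eq_ite,
    ofMul_eq_zero, mul_inv_eq_one]
  simp [mul_comm]

lemma fourier_inversion_indicator [DecidableEq A] (D : Finset A) (g : A) :
    ∑ χ : AddChar (Additive A) ℂ, (∑ h ∈ D, χ (.ofMul h)) * χ (.ofMul g⁻¹)
      = Fintype.card A * (if g ∈ D then 1 else 0) := by
  rw [← fourier_inversion (fun h => if h ∈ D then 1 else 0)]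
  simp [ite_mul, Finset.sum_ite_mem]

/-- An integral character sum is fixed by the Galois automorphisms. -/
lemma charSum_pow_eq {D : Finset A} {χ : AddChar (Additive A) ℂ} {θ : ℤ}
    (h : ∑ g ∈ D, χ (.ofMul g) = θ) {u : ℕ} (hu : u.Coprime (Fintype.card A)) :
    ∑ g ∈ D, (χ ^ u) (.ofMul g) = θ := by
  have hcard : Fintype.card A ≠ 0 := Fintype.card_ne_zero
  have hζ := Complex.isPrimitiveRoot_exp _ hcard
  set ζ := Complex.exp (2 * Real.pi * Complex.I / Fintype.card A)
  have hex : ∀ g : A, ∃ i : ℕ, ζ ^ i = χ (.ofMul g) := by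
    intro g
    have hχ : χ (.ofMul g) ^ Fintype.card A = 1 := by
      rw [← addChar_apply_pow, pow_card_eq_one, addChar_apply_one]
    have : NeZero (Fintype.card A) := ⟨hcard⟩
    obtain ⟨i, -, hi⟩ := hζ.eq_pow_of_pow_eq_one hχ
    exact ⟨i, hi⟩
  choose e he using hex
  let P : Polynomial ℤ := ∑ g ∈ D, Polynomial.X ^ e g - Polynomial.C θ
  have haeval : ∀ x : ℂ, Polynomial.aeval x P = ∑ g ∈ D, x ^ e g - θ := by
    intro x; simp [P]
  have hP : Polynomial.aeval ζ P = 0 := by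
    rw [haeval, ← h, sub_eq_zero]
    exact Finset.sum_congr rfl fun g _ => he g
  have hdvd : minpoly ℤ ζ ∣ P :=
    minpoly.isIntegrallyClosed_dvd (hζ.isIntegral (Nat.pos_of_ne_zero hcard)) hP
  rw [hζ.minpoly_eq_pow_coprime hu] at hdvd
  have h0 : Polynomial.aeval (ζ ^ u) P = 0 := by
    obtain ⟨R, hR⟩ := hdvd
    rw [hR, map_mul, minpoly.aeval, zero_mul]
  rw [haeval, sub_eq_zero] at h0
  rw [← h0]
  refine Finset.sum_congr rfl fun g _ => ?_
  rw [AddChar.pow_apply, ← he, ← pow_mul, ← pow_mul, mul_comm]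

/-- A set with integral character sums is closed under powers coprime to the group order. -/
lemma pow_mem_of_charSum_int {D : Finset A}
    (hD : ∀ χ : AddChar (Additive A) ℂ, ∃ θ : ℤ, ∑ g ∈ D, χ (.ofMul g) = θ)
    {u : ℕ} (hu : u.Coprime (Fintype.card A)) {g : A} (hg : g ∈ D) : g ^ u ∈ D := by
  classical
  have hcop : (Nat.card (AddChar (Additive A) ℂ)).Coprime u := by
    rw [Nat.card_eq_fintype_card, AddChar.card_eq, Fintype.card_additive]
    exact hu.symm
  have h1 := fourier_inversion_indicator D (g ^ u)
  have h2 := fourier_inversion_indicator D g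
  rw [← Equiv.sum_comp (powCoprime hcop)] at h2
  have h3 : ∀ χ : AddChar (Additive A) ℂ,
      (∑ h ∈ D, (powCoprime hcop χ) (.ofMul h)) * (powCoprime hcop χ) (.ofMul g⁻¹)
        = (∑ h ∈ D, χ (.ofMul h)) * χ (.ofMul (g ^ u)⁻¹) := by
    intro χ
    obtain ⟨θ, hθ⟩ := hD χ
    rw [powCoprime_apply, charSum_pow_eq hθ hu, hθ, AddChar.pow_apply, ← addChar_apply_pow,
      inv_pow]
  simp_rw [h3] at h2
  rw [h1, if_pos hg] at h2
  by_contra hgu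
  rw [if_neg hgu, mul_zero, mul_one] at h2
  exact Nat.cast_ne_zero.2 Fintype.card_ne_zero h2.symm

/-- If `q ^ 2` divides the difference of the two values of the nontrivial character sums of `D`,
then `D` is almost periodic. -/
lemma mem_iff_mul_mem_of_sq_dvd {D : Finset A} {θ₁ θ₂ : ℤ}
    (hD : ∀ χ : AddChar (Additive A) ℂ, χ ≠ 1 →
      ∑ g ∈ D, χ (.ofMul g) = θ₁ ∨ ∑ g ∈ D, χ (.ofMul g) = θ₂)
    {q w m : ℕ} (hq : q.Prime) (hcard : Fintype.card A = q ^ 3 * m) (hm : ¬ q ∣ m)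
    (hqw : q ∣ w) (hw : (w + 1).Coprime (Fintype.card A)) (hexp : ∀ g : A, g ^ (w * q) = 1)
    (hdvd : (q : ℤ) ^ 2 ∣ θ₁ - θ₂) (z : A) {g : A} (hg : g ≠ 1) (hzg : z ^ w * g ≠ 1) :
    z ^ w * g ∈ D ↔ g ∈ D := by
  classical
  set T : AddChar (Additive A) ℂ → ℂ := fun χ =>
    (χ (.ofMul (z ^ w)⁻¹) - 1) * χ (.ofMul g⁻¹) with hT
  set S : Finset (AddChar (Additive A) ℂ) := Finset.univ.filter fun χ =>
    χ (.ofMul (z ^ w)) ≠ 1 ∧ ∑ h ∈ D, χ (.ofMul h) = θ₁ with hS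
  have hzw : ∀ χ : AddChar (Additive A) ℂ, χ (.ofMul (z ^ w)) ^ w = 1 := by
    intro χ
    rw [← addChar_apply_pow, ← pow_mul, pow_mul_self_eq_one hqw hexp, addChar_apply_one]
  have hmem : ∑ χ ∈ S, T χ ∈ strictMultiples q := by
    refine sum_mem_of_orbit_sums_mem (strictMultiples q).toAddSubmonoid hq hqw
      (addChar_pow_eq_one hexp) T S ?_ ?_ ?_
    · intro χ hχ
      rw [hS, Finset.mem_filter] at hχ ⊢
      refine ⟨Finset.mem_univ _, ?_, charSum_pow_eq hχ.2.2 hw⟩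
      rw [AddChar.pow_apply, pow_succ, hzw, one_mul]
      exact hχ.2.1
    · intro χ hχ h1
      rw [hS, Finset.mem_filter] at hχ
      apply hχ.2.1
      rw [addChar_apply_pow, ← AddChar.pow_apply, h1, AddChar.one_apply]
    · intro χ _
      have hζ : χ (.ofMul (z ^ w)⁻¹) ^ q = 1 := by
        rw [← addChar_apply_pow, inv_pow, ← pow_mul, hexp, inv_one, addChar_apply_one]
      have hω : (χ (.ofMul g⁻¹) ^ w) ^ q = 1 := by
        rw [← pow_mul, ← addChar_apply_pow, hexp, addChar_apply_one]
      rw [AddSubgroup.mem_toAddSubmonoid]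
      convert sum_sub_one_mul_mem_strictMultiples hq hζ hω (isIntegral_addChar_apply χ g⁻¹)
        using 1
      refine Finset.sum_congr rfl fun j _ => ?_
      have h1 : χ (.ofMul (z ^ w)⁻¹) ^ w = 1 := by
        rw [← addChar_apply_pow, inv_pow, ← pow_mul, pow_mul_self_eq_one hqw hexp, inv_one,
          addChar_apply_one]
      simp only [hT, AddChar.pow_apply]
      rw [pow_succ, pow_mul, h1, one_pow, one_mul, pow_succ, pow_mul]
      ring
  have hsum : ((θ₁ - θ₂ : ℤ) : ℂ) * ∑ χ ∈ S, T χ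
      = ∑ χ : AddChar (Additive A) ℂ, (∑ h ∈ D, χ (.ofMul h) - θ₂) * T χ := by
    rw [hS, Finset.sum_filter, Finset.mul_sum]
    refine Finset.sum_congr rfl fun χ _ => ?_
    by_cases hχ : χ (.ofMul (z ^ w)) = 1
    · have : χ (.ofMul (z ^ w)⁻¹) = 1 := by rw [ofMul_inv, AddChar.map_neg_eq_inv, hχ, inv_one]
      rw [if_neg (fun h => h.1 hχ), hT]
      simp only [this, sub_self, zero_mul, mul_zero]
    · have h1 : χ ≠ 1 := by rintro rfl; exact hχ (AddChar.one_apply _)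
      by_cases h2 : ∑ h ∈ D, χ (.ofMul h) = θ₁
      · rw [if_pos ⟨hχ, h2⟩, h2, Int.cast_sub]
      · have h3 := (hD χ h1).resolve_left h2
        rw [if_neg (fun h => h2 h.2), h3, sub_self, mul_zero, zero_mul]
  have hexpand : ∑ χ : AddChar (Additive A) ℂ, (∑ h ∈ D, χ (.ofMul h) - θ₂) * T χ
      = Fintype.card A * ((if z ^ w * g ∈ D then 1 else 0) - (if g ∈ D then 1 else 0)) := by
    have h0 : ∀ x : A, x ≠ 1 → ∑ χ : AddChar (Additive A) ℂ, χ (.ofMul x⁻¹) = 0 := by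
      intro x hx
      rw [AddChar.sum_apply_eq_zero_iff_ne_zero]
      simpa using hx
    have h1 := fourier_inversion_indicator D (z ^ w * g)
    have h2 := fourier_inversion_indicator D g
    rw [mul_sub, ← h1, ← h2, ← Finset.sum_sub_distrib]
    have h3 : ∑ χ : AddChar (Additive A) ℂ,
        (θ₂ : ℂ) * (χ (.ofMul (z ^ w * g)⁻¹) - χ (.ofMul g⁻¹)) = 0 := by
      rw [← Finset.mul_sum, Finset.sum_sub_distrib, h0 _ hzg, h0 _ hg, sub_zero, mul_zero]
    refine Eq.trans ?_ (sub_zero _)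
    rw [← h3, ← Finset.sum_sub_distrib]
    refine Finset.sum_congr rfl fun χ _ => ?_
    simp only [hT, mul_inv (z ^ w) g, addChar_apply_mul]
    ring
  obtain ⟨s, hs⟩ := hdvd
  set d : ℤ := (if z ^ w * g ∈ D then 1 else 0) - (if g ∈ D then 1 else 0) with hd
  have hqmd : ((q * m * d : ℤ) : ℂ) ∈ strictMultiples q := by
    have : ((q * m * d : ℤ) : ℂ) = s • ∑ χ ∈ S, T χ := by
      have hq0 : (q : ℂ) ^ 2 ≠ 0 := pow_ne_zero _ (Nat.cast_ne_zero.2 hq.ne_zero)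
      apply mul_left_cancel₀ hq0
      rw [hexpand, hs, hcard] at hsum
      rw [zsmul_eq_mul, ← mul_assoc]
      push_cast [hd] at hsum ⊢
      rw [hsum]
      ring
    rw [this]
    exact AddSubgroup.zsmul_mem _ hmem s
  have hdiv := sq_dvd_of_mem_strictMultiples hq hqmd
  rw [pow_two, mul_assoc, mul_dvd_mul_iff_left (Int.natCast_ne_zero.2 hq.ne_zero)] at hdiv
  have hqZ := Nat.prime_iff_prime_int.1 hq
  have hd0 : (q : ℤ) ∣ d := (hqZ.dvd_or_dvd hdiv).resolve_left (by exact_mod_cast hm)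
  by_cases h1 : z ^ w * g ∈ D <;> by_cases h2 : g ∈ D <;> simp [h1, h2, hd] at hd0 ⊢
  · exact hqZ.not_dvd_one hd0
  · exact hqZ.not_dvd_one hd0

/-- If `q ^ 2` does not divide the difference of the two values of the nontrivial character sums
of `D`, then `D` or its complement is contained in the kernel of a nontrivial character. -/
lemma exists_addChar_of_not_sq_dvd {D : Finset A} {θ₁ θ₂ : ℤ}
    (hD : ∀ χ : AddChar (Additive A) ℂ, χ ≠ 1 →
      ∑ g ∈ D, χ (.ofMul g) = θ₁ ∨ ∑ g ∈ D, χ (.ofMul g) = θ₂)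
    {q w : ℕ} (hq : q.Prime)
    (hqw : q ∣ w) (hw : (w + 1).Coprime (Fintype.card A)) (hexp : ∀ g : A, g ^ (w * q) = 1)
    (hdvd : ¬ (q : ℤ) ^ 2 ∣ θ₁ - θ₂) {z : A} (hz : z ^ w ≠ 1) :
    ∃ τ : AddChar (Additive A) ℂ, τ ≠ 1 ∧
      ((∀ g ∈ D, τ (.ofMul g) = 1) ∨ ∀ g, τ (.ofMul g) ≠ 1 → g ∈ D) := by
  classical
  obtain ⟨ρ, hρ⟩ := AddChar.exists_apply_ne_zero.2 (show Additive.ofMul (z ^ w) ≠ 0 by simpa)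
  set τ := ρ ^ w with hτ
  have hτρ : ∀ g, τ (.ofMul g) = ρ (.ofMul g) ^ w := fun g => AddChar.pow_apply _ _ _
  have hτ1 : τ ≠ 1 := by
    intro h
    apply hρ
    rw [addChar_apply_pow, ← hτρ, h, AddChar.one_apply]
  refine ⟨τ, hτ1, ?_⟩
  have hclosed : ∀ g ∈ D, g ^ (w + 1) ∈ D := by
    refine fun g => pow_mem_of_charSum_int (fun χ => ?_) hw
    by_cases hχ : χ = 1
    · exact ⟨D.card, by simp [hχ]⟩
    · rcases hD χ hχ with h | h <;> exact ⟨_, h⟩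
  have hτw : ∀ g, τ (.ofMul g) ^ w = 1 := by
    intro g
    rw [hτρ, ← pow_mul, ← addChar_apply_pow, pow_mul_self_eq_one hqw hexp, addChar_apply_one]
  have hvanish : ∀ χ : AddChar (Additive A) ℂ, χ ≠ 1 → χ ≠ τ⁻¹ →
      ∑ g ∈ D, (τ (.ofMul g) - 1) * χ (.ofMul g) = 0 := by
    intro χ hχ hχτ
    have hmem : ∑ g ∈ D.filter fun g => τ (.ofMul g) ≠ 1, (τ (.ofMul g) - 1) * χ (.ofMul g)
        ∈ strictMultiples q := by
      refine sum_mem_of_orbit_sums_mem (strictMultiples q).toAddSubmonoid hq hqw hexp _ _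
        ?_ ?_ ?_
      · intro g hg
        rw [Finset.mem_filter] at hg ⊢
        refine ⟨hclosed g hg.1, ?_⟩
        rw [addChar_apply_pow, pow_succ, hτw, one_mul]
        exact hg.2
      · intro g hg h1
        apply (Finset.mem_filter.1 hg).2
        rw [hτρ, ← addChar_apply_pow, h1, addChar_apply_one]
      · intro g _
        have hζ : τ (.ofMul g) ^ q = 1 := by
          rw [hτρ, ← pow_mul, ← addChar_apply_pow, hexp, addChar_apply_one]
        have hω : (χ (.ofMul g) ^ w) ^ q = 1 := by
          rw [← pow_mul, ← addChar_apply_pow, hexp, addChar_apply_one]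
        rw [AddSubgroup.mem_toAddSubmonoid]
        convert sum_sub_one_mul_mem_strictMultiples hq hζ hω (isIntegral_addChar_apply χ g)
          using 1
        refine Finset.sum_congr rfl fun j _ => ?_
        rw [addChar_apply_pow, addChar_apply_pow, pow_succ, pow_mul, hτw, one_pow, one_mul,
          pow_succ, pow_mul]
        ring
    have hfilter : ∑ g ∈ D.filter fun g => τ (.ofMul g) ≠ 1, (τ (.ofMul g) - 1) * χ (.ofMul g)
        = ∑ g ∈ D, (τ (.ofMul g) - 1) * χ (.ofMul g) := by
      refine Finset.sum_filter_of_ne fun g _ h h1 => h ?_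
      rw [h1, sub_self, zero_mul]
    have hsub : ∑ g ∈ D, (τ (.ofMul g) - 1) * χ (.ofMul g)
        = ∑ g ∈ D, (τ * χ) (.ofMul g) - ∑ g ∈ D, χ (.ofMul g) := by
      simp_rw [sub_mul, one_mul, Finset.sum_sub_distrib, AddChar.mul_apply]
    rw [hfilter, hsub] at hmem
    rw [hsub]
    have hτχ : τ * χ ≠ 1 := fun h => hχτ (eq_inv_of_mul_eq_one_right h)
    rcases hD _ hτχ with h1 | h1 <;> rcases hD χ hχ with h2 | h2 <;>
      rw [h1, h2] at hmem ⊢ <;> try rw [sub_self]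
    · exact absurd (sq_dvd_of_mem_strictMultiples hq (by exact_mod_cast hmem)) hdvd
    · rw [← Int.cast_sub] at hmem
      have := sq_dvd_of_mem_strictMultiples hq hmem
      exact absurd ((dvd_sub_comm).1 this) hdvd
  set F : A → ℂ := fun g => (if g ∈ D then 1 else 0) * (τ (.ofMul g) - 1) with hF
  have hhat : ∀ χ : AddChar (Additive A) ℂ, ∑ g, F g * χ (.ofMul g)
      = ∑ g ∈ D, (τ (.ofMul g) - 1) * χ (.ofMul g) := by
    intro χ
    simp [hF, ite_mul, Finset.sum_ite_mem]
  have hinv : ∀ g, Fintype.card A * F g = (∑ h, F h * (1 : AddChar (Additive A) ℂ) (.ofMul h))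
      + (∑ h, F h * τ⁻¹ (.ofMul h)) * τ (.ofMul g) := by
    intro g
    rw [← fourier_inversion, ← Finset.sum_subset (Finset.subset_univ {1, τ⁻¹})]
    · rw [Finset.sum_pair (by simpa [eq_comm] using hτ1)]
      rw [AddChar.one_apply, mul_one, AddChar.inv_apply τ (.ofMul g⁻¹), ofMul_inv, neg_neg]
    · intro χ _ hχ
      simp only [Finset.mem_insert, Finset.mem_singleton, not_or] at hχ
      rw [hhat, hvanish χ hχ.1 hχ.2, zero_mul]
  set a := ∑ h, F h * (1 : AddChar (Additive A) ℂ) (.ofMul h)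
  set b := ∑ h, F h * τ⁻¹ (.ofMul h)
  have hab : a = -b := by
    have := hinv 1
    simp only [hF, addChar_apply_one, sub_self, mul_zero, mul_one] at this
    exact eq_neg_of_add_eq_zero_left this.symm
  have hconst : ∀ g, τ (.ofMul g) ≠ 1 → Fintype.card A * (if g ∈ D then 1 else 0) = b := by
    intro g hg
    apply mul_right_cancel₀ (sub_ne_zero.2 hg)
    have := hinv g
    rw [hab] at this
    simp only [hF] at this
    linear_combination this
  by_cases hb : b = 0
  · left
    intro g hg
    by_contra h
    have := hconst g h
    rw [if_pos hg, hb, mul_one] at this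
    exact Nat.cast_ne_zero.2 Fintype.card_ne_zero this
  · right
    intro g h
    by_contra hg
    have := hconst g h
    rw [if_neg hg, mul_zero] at this
    exact hb this.symm

end Characters

section PartialDifferenceSet

lemma pdsReps_eq_card_filter {G : Type*} [CommGroup G] [DecidableEq G] (D : Finset G) {g : G}
    (hg : g ≠ 1) :
    pdsReps D g = (D.filter fun x => g⁻¹ * x ∈ D).card := by
  refine Finset.card_bij (fun x _ => x.1) ?_ ?_ ?_
  · rintro ⟨a, b⟩ h
    simp only [Finset.mem_filter, Finset.mem_product] at h ⊢
    obtain ⟨⟨ha, hb⟩, -, rfl⟩ := h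
    exact ⟨ha, by simpa using hb⟩
  · rintro ⟨a, b⟩ h ⟨a', b'⟩ h' hab
    simp only [Finset.mem_filter, Finset.mem_product] at h h' hab
    obtain ⟨-, -, rfl⟩ := h
    have h2 := h'.2.2
    rw [hab] at h2 ⊢
    simpa [eq_comm] using h2
  · intro x hx
    simp only [Finset.mem_filter] at hx
    refine ⟨(x, g⁻¹ * x), ?_, rfl⟩
    simp only [Finset.mem_filter, Finset.mem_product]
    refine ⟨hx, fun h => hg ?_, by simp⟩
    simpa using h

lemma IsRegularPDS.inv_mem_iff {G : Type*} [CommGroup G] {D : Finset G} (hreg : IsRegularPDS D)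
    {g : G} : g⁻¹ ∈ D ↔ g ∈ D :=
  ⟨fun h => inv_inv g ▸ hreg.1 _ h, hreg.1 g⟩

variable {D : Finset G} {v k l m : ℕ}

lemma IsPDS.charSum_sq (h : IsPDS D v k l m) (hreg : IsRegularPDS D)
    {χ : AddChar (Additive G) ℂ} (hχ : χ ≠ 1) :
    (∑ g ∈ D, χ (.ofMul g)) ^ 2 = (k - m) + (l - m) * ∑ g ∈ D, χ (.ofMul g) := by
  obtain ⟨-, hk, hl, hm⟩ := h
  have hinv : ∑ g ∈ D, χ (.ofMul g⁻¹) = ∑ g ∈ D, χ (.ofMul g) :=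
    Finset.sum_nbij' (·⁻¹) (·⁻¹) hreg.1 hreg.1 (by simp) (by simp) (by simp)
  have hcount : ∀ g : G, (((D ×ˢ D).filter fun x => x.1 * x.2⁻¹ = g).card : ℂ)
      = m + (l - m) * (if g ∈ D then 1 else 0) + (k - m) * (if g = 1 then 1 else 0) := by
    intro g
    by_cases hg : g = 1
    · subst hg
      have : (D ×ˢ D).filter (fun x => x.1 * x.2⁻¹ = 1) = D.diag := by
        ext ⟨a, b⟩
        simp only [Finset.mem_filter, Finset.mem_product, Finset.mem_diag, mul_inv_eq_one]
        constructor
        · exact fun h => ⟨h.1.1, h.2⟩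
        · rintro ⟨ha, rfl⟩
          exact ⟨⟨ha, ha⟩, rfl⟩
      rw [this, Finset.diag_card, hk, if_neg hreg.2, if_pos rfl]
      ring
    · have : (D ×ˢ D).filter (fun x => x.1 * x.2⁻¹ = g)
          = (D ×ˢ D).filter (fun x => x.1 ≠ x.2 ∧ x.1 * x.2⁻¹ = g) := by
        refine Finset.filter_congr fun x _ => ⟨fun h => ⟨fun h1 => hg ?_, h⟩, And.right⟩
        rw [← h, h1, mul_inv_cancel]
      rw [this, if_neg hg]
      change (pdsReps D g : ℂ) = _
      by_cases hgD : g ∈ D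
      · rw [hl g hg hgD, if_pos hgD]; ring
      · rw [hm g hg hgD, if_neg hgD]; ring
  have hχ0 : ∑ g : G, χ (.ofMul g) = 0 := by
    have := AddChar.sum_eq_zero_iff_ne_zero.2 hχ
    rwa [← Equiv.sum_comp Additive.ofMul] at this
  calc (∑ g ∈ D, χ (.ofMul g)) ^ 2
      = ∑ x ∈ D ×ˢ D, χ (.ofMul (x.1 * x.2⁻¹)) := by
        rw [pow_two]
        nth_rw 2 [← hinv]
        rw [Finset.sum_mul_sum, ← Finset.sum_product']
        simp only [addChar_apply_mul]
    _ = ∑ g : G, (((D ×ˢ D).filter fun x => x.1 * x.2⁻¹ = g).card : ℂ) * χ (.ofMul g) := by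
        rw [← Finset.sum_fiberwise (D ×ˢ D) (fun x => x.1 * x.2⁻¹)]
        refine Finset.sum_congr rfl fun g _ => ?_
        rw [← nsmul_eq_mul]
        refine Finset.sum_eq_card_nsmul fun x hx => ?_
        rw [(Finset.mem_filter.1 hx).2]
    _ = (m : ℂ) * ∑ g : G, χ (.ofMul g) + (l - m) * ∑ g ∈ D, χ (.ofMul g) + (k - m) := by
        simp only [hcount, add_mul, Finset.sum_add_distrib, mul_assoc, ← Finset.mul_sum, ite_mul,
          one_mul, zero_mul, Finset.sum_ite_mem, Finset.univ_inter, Finset.sum_ite_eq',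
          Finset.mem_univ, if_true, addChar_apply_one, mul_one]
    _ = _ := by rw [hχ0]; ring

lemma IsPDS.exists_charSum_values (h : IsPDS D v k l m) (hreg : IsRegularPDS D)
    (heven : 2 ∣ Fintype.card G) :
    ∃ θ₁ θ₂ : ℤ, ∀ χ : AddChar (Additive G) ℂ, χ ≠ 1 →
      ∑ g ∈ D, χ (.ofMul g) = θ₁ ∨ ∑ g ∈ D, χ (.ofMul g) = θ₂ := by
  have : Fact (Nat.Prime 2) := ⟨Nat.prime_two⟩
  obtain ⟨χ₀, hχ₀⟩ := exists_prime_orderOf_dvd_card (G := AddChar (Additive G) ℂ) 2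
    (by rwa [AddChar.card_eq, Fintype.card_additive])
  have h1 : χ₀ ≠ 1 := by rintro rfl; simp at hχ₀
  have hsign : ∀ g : G, ∃ e : ℤ, χ₀ (.ofMul g) = e := by
    intro g
    have : χ₀ (.ofMul g) ^ 2 = 1 := by
      rw [← AddChar.pow_apply, ← hχ₀, pow_orderOf_eq_one, AddChar.one_apply]
    rcases eq_or_eq_neg_of_sq_eq_sq _ 1 (this.trans (one_pow 2).symm) with h | h
    · exact ⟨1, by simp [h]⟩
    · exact ⟨-1, by simp [h]⟩
  choose e he using hsign
  refine ⟨∑ g ∈ D, e g, l - m - ∑ g ∈ D, e g, fun χ hχ => ?_⟩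
  have h₀ := h.charSum_sq hreg h1
  have h₂ := h.charSum_sq hreg hχ
  simp only [he] at h₀
  set x := ∑ g ∈ D, χ (.ofMul g)
  push_cast
  rw [← sub_eq_zero, ← sub_eq_zero (a := x) (b := _ - _), ← mul_eq_zero]
  linear_combination h₂ - h₀

lemma IsPDS.isTrivialPDS_of_subset_ker (h : IsPDS D v k l m) (hreg : IsRegularPDS D)
    {τ : AddChar (Additive G) ℂ} (hτ : τ ≠ 1) (hD : ∀ g ∈ D, τ (.ofMul g) = 1) :
    IsTrivialPDS D := by
  obtain ⟨-, -, -, hm⟩ := h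
  obtain ⟨x, hx⟩ := AddChar.ne_one_iff.1 hτ
  obtain ⟨x, rfl⟩ := Additive.ofMul.surjective x
  have hx1 : x ≠ 1 := by rintro rfl; exact hx (addChar_apply_one τ)
  have hm0 : m = 0 := by
    rw [← hm x hx1 fun h => hx (hD x h), pdsReps_eq_card_filter D hx1, Finset.card_eq_zero,
      Finset.filter_eq_empty_iff]
    intro y hy h
    have := hD _ h
    rw [addChar_apply_mul, hD y hy, mul_one, ofMul_inv, AddChar.map_neg_eq_inv, inv_eq_one] at this
    exact hx this
  have hmul : ∀ a ∈ D, ∀ b ∈ D, a * b ≠ 1 → a * b ∈ D := by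
    intro a ha b hb hab
    by_contra hn
    have := hm _ hab hn
    rw [hm0, pdsReps_eq_card_filter D hab, Finset.card_eq_zero, Finset.filter_eq_empty_iff] at this
    exact this ha (by simpa using hreg.1 b hb)
  refine Or.inl ⟨{ carrier := ↑D ∪ {1}, mul_mem' := ?_, one_mem' := by simp, inv_mem' := ?_ }, rfl⟩
  · rintro a b (ha | rfl) (hb | rfl)
    · by_cases hab : a * b = 1
      · exact Or.inr hab
      · exact Or.inl (hmul a ha b hb hab)
    · simpa using Or.inr ha
    · simpa using Or.inr hb
    · simp
  · rintro a (ha | rfl)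
    · exact Or.inl (hreg.1 a ha)
    · simp

lemma IsPDS.isTrivialPDS_of_compl_ker_subset (h : IsPDS D v k l m) (hreg : IsRegularPDS D)
    {τ : AddChar (Additive G) ℂ} (hτ : τ ≠ 1) (hD : ∀ g, τ (.ofMul g) ≠ 1 → g ∈ D) :
    IsTrivialPDS D := by
  obtain ⟨-, hk, hl, -⟩ := h
  obtain ⟨x, hx⟩ := AddChar.ne_one_iff.1 hτ
  obtain ⟨x, rfl⟩ := Additive.ofMul.surjective x
  have hsub : ∀ g, (D.filter fun y => g⁻¹ * y ∉ D) ⊆ Dᶜ.image (g * ·) := by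
    intro g y hy
    exact Finset.mem_image.2
      ⟨g⁻¹ * y, Finset.mem_compl.2 (Finset.mem_filter.1 hy).2, by simp⟩
  have hcompl : ∀ g ∈ D, (D.filter fun y => g⁻¹ * y ∉ D).card = k - l := by
    intro g hg
    have hg1 : g ≠ 1 := by rintro rfl; exact hreg.2 hg
    have := Finset.card_filter_add_card_filter_not (s := D) fun y => g⁻¹ * y ∈ D
    rw [← pdsReps_eq_card_filter D hg1, hl g hg1 hg, hk] at this
    omega
  have hcard : ∀ g : G, (Dᶜ.image (g * ·)).card = Dᶜ.card := fun g =>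
    Finset.card_image_of_injective _ (mul_right_injective g)
  have hx' : (D.filter fun y => x⁻¹ * y ∉ D) = Dᶜ.image (x * ·) := by
    refine (hsub x).antisymm fun y hy => ?_
    obtain ⟨e, he, rfl⟩ := Finset.mem_image.1 hy
    rw [Finset.mem_compl] at he
    refine Finset.mem_filter.2 ⟨hD _ ?_, by simpa using he⟩
    rw [addChar_apply_mul, not_imp_comm.1 (hD e) he, mul_one]
    exact hx
  have hkl : k - l = Dᶜ.card := by rw [← hcompl x (hD x hx), hx', hcard]
  have hmul : ∀ g ∈ D, ∀ e ∉ D, g * e ∈ D := by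
    intro g hg e he
    have heq := Finset.eq_of_subset_of_card_le (hsub g) (by rw [hcard, hcompl g hg, hkl])
    have : g * e ∈ D.filter fun y => g⁻¹ * y ∉ D := by
      rw [heq]
      exact Finset.mem_image_of_mem _ (Finset.mem_compl.2 he)
    exact (Finset.mem_filter.1 this).1
  refine Or.inr ⟨{ carrier := (↑D)ᶜ, mul_mem' := ?_, one_mem' := hreg.2, inv_mem' := ?_ }, rfl⟩
  · intro a b ha hb hab
    have := hmul _ hab b⁻¹ (fun h => hb (hreg.inv_mem_iff.1 h))
    exact ha (by simpa using this)
  · exact fun ha h => ha (hreg.inv_mem_iff.1 h)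

lemma IsPDS.isTrivialPDS_of_almost_periodic (h : IsPDS D v k l m) (hreg : IsRegularPDS D)
    {c : G} (hc : c ≠ 1) (hD : ∀ g, g ≠ 1 → c * g ≠ 1 → (c * g ∈ D ↔ g ∈ D)) :
    IsTrivialPDS D := by
  obtain ⟨-, hk, hl, hm⟩ := h
  have hshift : ∀ x ∈ D, x ≠ c → c⁻¹ * x ∈ D := by
    intro x hx hxc
    have hx1 : x ≠ 1 := by rintro rfl; exact hreg.2 hx
    refine (hD _ (fun h => hxc (inv_mul_eq_one.1 h).symm) (by simpa using hx1)).1 ?_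
    simpa using hx
  by_cases hcD : c ∈ D
  · have hl' : l = k - 1 := by
      rw [← hl c hc hcD, pdsReps_eq_card_filter D hc, ← hk, ← Finset.card_erase_of_mem hcD]
      congr 1
      ext x
      simp only [Finset.mem_filter, Finset.mem_erase]
      refine ⟨fun hx => ⟨?_, hx.1⟩, fun hx => ⟨hx.2, hshift x hx.2 hx.1⟩⟩
      rintro rfl
      exact hreg.2 (by simpa using hx.2)
    have hmul : ∀ g ∈ D, ∀ x ∈ D, x ≠ g → g⁻¹ * x ∈ D := by
      intro g hg x hx hxg
      have hg1 : g ≠ 1 := by rintro rfl; exact hreg.2 hg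
      have hsub : (D.filter fun x => g⁻¹ * x ∈ D) ⊆ D.erase g := by
        intro y hy
        rw [Finset.mem_filter] at hy
        refine Finset.mem_erase.2 ⟨?_, hy.1⟩
        rintro rfl
        exact hreg.2 (by simpa using hy.2)
      have heq := Finset.eq_of_subset_of_card_le hsub (by
        rw [← pdsReps_eq_card_filter D hg1, hl g hg1 hg, hl', Finset.card_erase_of_mem hg, hk])
      have : x ∈ D.filter fun x => g⁻¹ * x ∈ D := by
        rw [heq]
        exact Finset.mem_erase.2 ⟨hxg, hx⟩
      exact (Finset.mem_filter.1 this).2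
    refine Or.inl
      ⟨{ carrier := ↑D ∪ {1}, mul_mem' := ?_, one_mem' := by simp, inv_mem' := ?_ }, rfl⟩
    · rintro a b (ha | rfl) (hb | rfl)
      · by_cases hab : b = a⁻¹
        · exact Or.inr (by simp [hab])
        · have := hmul _ (hreg.1 a ha) b hb hab
          exact Or.inl (by simpa using this)
      · simpa using Or.inr ha
      · simpa using Or.inr hb
      · simp
    · rintro a (ha | rfl)
      · exact Or.inl (hreg.1 a ha)
      · simp
  · have hm' : m = k := by
      rw [← hm c hc hcD, pdsReps_eq_card_filter D hc, ← hk, Finset.filter_true_of_mem]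
      exact fun x hx => hshift x hx fun hxc => hcD (hxc ▸ hx)
    have hmul : ∀ g ∉ D, ∀ x ∈ D, g⁻¹ * x ∈ D := by
      intro g hg x hx
      by_cases hg1 : g = 1
      · simpa [hg1] using hx
      have heq := Finset.eq_of_subset_of_card_le
        (Finset.filter_subset (fun x => g⁻¹ * x ∈ D) D) (by
          rw [← pdsReps_eq_card_filter D hg1, hm g hg1 hg, hm', hk])
      rw [← heq] at hx
      exact (Finset.mem_filter.1 hx).2
    refine Or.inr ⟨{ carrier := (↑D)ᶜ, mul_mem' := ?_, one_mem' := hreg.2, inv_mem' := ?_ }, rfl⟩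
    · intro a b ha hb hab
      have := hmul a ha _ hab
      exact hb (by simpa using this)
    · exact fun ha h => ha (hreg.inv_mem_iff.1 h)

/-- A Sylow subgroup of order `q ^ 3` of a group of even order with a nontrivial regular PDS is
elementary abelian. -/
lemma IsPDS.pow_eq_one_of_card_eq (h : IsPDS D v k l m) (hreg : IsRegularPDS D)
    (hnt : ¬ IsTrivialPDS D) (heven : 2 ∣ Fintype.card G) {q n : ℕ} (hq : q.Prime)
    (hcard : Fintype.card G = q ^ 3 * n) (hn : ¬ q ∣ n) (g : G) : g ^ (q * n) = 1 := by
  obtain ⟨θ₁, θ₂, hθ⟩ := h.exists_charSum_values hreg heven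
  have key : ∀ w : ℕ, q ∣ w → n ∣ w → (∀ g : G, g ^ (w * q) = 1) → ∀ z : G, z ^ w = 1 := by
    intro w hqw hnw hexp z
    by_contra hz
    have hw : (w + 1).Coprime (Fintype.card G) := by
      have hcop : (w + 1).Coprime w := by simp
      rw [hcard]
      exact ((hcop.coprime_dvd_right hqw).pow_right 3).mul_right (hcop.coprime_dvd_right hnw)
    by_cases hdvd : (q : ℤ) ^ 2 ∣ θ₁ - θ₂
    · exact hnt (h.isTrivialPDS_of_almost_periodic hreg hz fun g =>
        mem_iff_mul_mem_of_sq_dvd hθ hq hcard hn hqw hw hexp hdvd z)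
    · obtain ⟨τ, hτ, hker | hker⟩ := exists_addChar_of_not_sq_dvd hθ hq hqw hw hexp hdvd hz
      · exact hnt (h.isTrivialPDS_of_subset_ker hreg hτ hker)
      · exact hnt (h.isTrivialPDS_of_compl_ker_subset hreg hτ hker)
  have hcard' : ∀ g : G, g ^ (q * q * n * q) = 1 := by
    intro g
    rw [show q * q * n * q = Fintype.card G by rw [hcard]; ring, pow_card_eq_one]
  refine key (q * n) (dvd_mul_right _ _) (dvd_mul_left _ _) (fun g => ?_) g
  rw [show q * n * q = q * q * n by ring]
  exact key (q * q * n) ⟨q * n, by ring⟩ (dvd_mul_left _ _) hcard' g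

end PartialDifferenceSet

section GroupStructure

lemma pow_eq_pow_of_coprime_mul_eq {a b i j r s : ℕ} (hab : a.Coprime b)
    (h : a ^ i * b ^ j = a ^ r * b ^ s) : a ^ i = a ^ r :=
  Nat.dvd_antisymm
    ((hab.pow i s).dvd_of_dvd_mul_right (h ▸ dvd_mul_right _ _))
    ((hab.pow r j).dvd_of_dvd_mul_right (h ▸ dvd_mul_right _ _))

/-- An additive group killed by `a * b` with `a` and `b` coprime splits as a product of its
`a`-torsion and its `b`-torsion. -/
lemma nonempty_torsionBy_prod_addEquiv {A : Type*} [AddCommGroup A] {a b : ℕ}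
    (hab : a.Coprime b) (hA : ∀ x : A, (a * b) • x = 0) :
    Nonempty (AddSubgroup.torsionBy A (a : ℤ) × AddSubgroup.torsionBy A (b : ℤ) ≃+ A) := by
  have hbez : (a : ℤ) * a.gcdA b + b * a.gcdB b = 1 := by
    rw [← Nat.gcd_eq_gcd_ab, hab.gcd_eq_one, Nat.cast_one]
  have hA' : ∀ x : A, ((a : ℤ) * b) • x = 0 := fun x => by
    rw [← Nat.cast_mul, natCast_zsmul, hA]
  refine ⟨AddEquiv.ofBijective ((AddSubgroup.subtype _).coprod (AddSubgroup.subtype _)) ⟨?_, ?_⟩⟩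
  · rw [injective_iff_map_eq_zero]
    rintro ⟨⟨x, hx⟩, ⟨y, hy⟩⟩ h
    have hx' : (a : ℤ) • x = 0 := hx
    have hy' : (b : ℤ) • y = 0 := hy
    have hxy : x = -y := eq_neg_of_add_eq_zero_left h
    have hx0 : x = 0 := by
      rw [← one_zsmul x, ← hbez, add_zsmul, mul_comm, mul_zsmul, hx', mul_comm (b : ℤ), mul_zsmul,
        hxy, smul_neg, hy']
      simp
    have hy0 : y = 0 := by simpa [hx0] using hxy
    simp [hx0, hy0]
  · intro x
    refine ⟨⟨⟨((b : ℤ) * a.gcdB b) • x, ?_⟩, ⟨((a : ℤ) * a.gcdA b) • x, ?_⟩⟩, ?_⟩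
    · change (a : ℤ) • _ = (0 : A)
      rw [← mul_zsmul, ← mul_assoc, mul_comm, mul_zsmul, hA', smul_zero]
    · change (b : ℤ) • _ = (0 : A)
      rw [← mul_zsmul, ← mul_assoc, mul_comm, mul_comm (b : ℤ), mul_zsmul, hA', smul_zero]
    · change ((b : ℤ) * a.gcdB b) • x + ((a : ℤ) * a.gcdA b) • x = x
      rw [← add_zsmul, add_comm, hbez, one_zsmul]

lemma nonempty_addEquiv_of_card_eq_prime_pow_three {p : ℕ} [Fact p.Prime] {V : Type*}
    [AddCommGroup V] [Module (ZMod p) V] [Finite V] (h : Nat.card V = p ^ 3) :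
    Nonempty (V ≃+ ZMod p × ZMod p × ZMod p) := by
  have hfin : Module.finrank (ZMod p) V = 3 := by
    rw [Module.natCard_eq_pow_finrank (K := ZMod p), Nat.card_zmod] at h
    exact Nat.pow_right_injective (Fact.out : p.Prime).two_le h
  refine (FiniteDimensional.nonempty_linearEquiv_of_finrank_eq (R := ZMod p) ?_).map
    LinearEquiv.toAddEquiv
  simp [hfin]

lemma nonempty_addEquiv_of_card_eq {p q : ℕ} (hp : p.Prime) (hq : q.Prime) (hpq : p ≠ q)
    {A : Type*} [AddCommGroup A] [Finite A] (hcard : Nat.card A = p ^ 3 * q ^ 3)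
    (hA : ∀ x : A, (p * q) • x = 0) :
    Nonempty (A ≃+ (ZMod p × ZMod p × ZMod p) × (ZMod q × ZMod q × ZMod q)) := by
  have : Fact p.Prime := ⟨hp⟩
  have : Fact q.Prime := ⟨hq⟩
  have hcop := (Nat.coprime_primes hp hq).2 hpq
  obtain ⟨e⟩ := nonempty_torsionBy_prod_addEquiv hcop hA
  have hprod := Nat.card_congr e.toEquiv
  rw [Nat.card_prod, hcard] at hprod
  let _ : Module (ZMod p) (AddSubgroup.torsionBy A (p : ℤ)) := AddSubgroup.torsionBy.zmodModule
  let _ : Module (ZMod q) (AddSubgroup.torsionBy A (q : ℤ)) := AddSubgroup.torsionBy.zmodModule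
  have hcp := Module.natCard_eq_pow_finrank (K := ZMod p) (V := AddSubgroup.torsionBy A (p : ℤ))
  have hcq := Module.natCard_eq_pow_finrank (K := ZMod q) (V := AddSubgroup.torsionBy A (q : ℤ))
  rw [Nat.card_zmod] at hcp hcq
  rw [hcp, hcq] at hprod
  obtain ⟨e₁⟩ := nonempty_addEquiv_of_card_eq_prime_pow_three
    (hcp.trans (pow_eq_pow_of_coprime_mul_eq hcop hprod))
  obtain ⟨e₂⟩ := nonempty_addEquiv_of_card_eq_prime_pow_three
    (hcq.trans (pow_eq_pow_of_coprime_mul_eq hcop.symm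
      (by rw [mul_comm, hprod, mul_comm])))
  exact ⟨e.symm.trans (e₁.prodCongr e₂)⟩

end GroupStructure

/-- If an Abelian group of order `8p^3`, `p ≥ 5` prime, contains a nontrivial
regular PDS, then it is isomorphic to `(ℤ/2)^3 × (ℤ/p)^3`. -/
theorem pds_group_structure (p : ℕ) (hp : p.Prime) (hp5 : 5 ≤ p)
    {G : Type*} [CommGroup G] [DecidableEq G] [Fintype G]
    (hex : ∃ (D : Finset G) (k l m : ℕ),
      IsPDS D (8 * p ^ 3) k l m ∧ IsRegularPDS D ∧ ¬ IsTrivialPDS D) :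
    Nonempty (G ≃* Multiplicative
      ((ZMod 2 × ZMod 2 × ZMod 2) × (ZMod p × ZMod p × ZMod p))) := by
  obtain ⟨D, k, l, m, h, hreg, hnt⟩ := hex
  have hcard : Fintype.card G = 2 ^ 3 * p ^ 3 := h.1
  have hp2 : 2 ≠ p := by omega
  have hcop : Nat.Coprime 2 p := (Nat.coprime_primes Nat.prime_two hp).2 hp2
  have heven : 2 ∣ Fintype.card G := hcard ▸ ⟨2 ^ 2 * p ^ 3, by ring⟩
  have h₂ := h.pow_eq_one_of_card_eq hreg hnt heven Nat.prime_two hcard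
    ((Nat.Prime.coprime_iff_not_dvd Nat.prime_two).1 (hcop.pow_right 3))
  have hₚ := h.pow_eq_one_of_card_eq hreg hnt heven hp (hcard.trans (mul_comm _ _))
    ((Nat.Prime.coprime_iff_not_dvd hp).1 (hcop.symm.pow_right 3))
  have hgcd : Nat.gcd (2 * p ^ 3) (p * 2 ^ 3) = 2 * p := by
    rw [show 2 * p ^ 3 = 2 * p * p ^ 2 by ring, show p * 2 ^ 3 = 2 * p * 2 ^ 2 by ring,
      Nat.gcd_mul_left, (hcop.symm.pow 2 2).gcd_eq_one, mul_one]
  have hexp : ∀ g : G, g ^ (2 * p) = 1 := fun g => hgcd ▸ pow_gcd_eq_one.2 ⟨h₂ g, hₚ g⟩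
  obtain ⟨e⟩ := nonempty_addEquiv_of_card_eq (A := Additive G) Nat.prime_two hp hp2
    (by rw [← hcard, ← Nat.card_eq_fintype_card]; rfl) hexp
  exact ⟨AddEquiv.toMultiplicativeRight e⟩
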